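/- Let x̄ ∈ ∂B₁, s̄ = sign(D*x̄), J̄ = cosupp(D*x̄), and F̄ = B₁ ∩ {x ∈ ℝ^n : ⟨Ds̄, x⟩ = 1}. Then: (i) F̄ = ∂B₁ ∩ {x : sign(D*x) ≼ s̄}, it contains x̄, and it is an exposed face of B₁; (ii) C ⊆ F̄ for every nonempty convex subset C ⊆ B₁ with x̄ ∈ ri(C); (iii) dir(F̄) = (Ds̄)⊥ ∩ Ker D*_J̄; (iv) ri(C) ⊆ ri(F̄) for every nonempty convex subset C ⊆ B₁ with x̄ ∈ ri(C); (v) ri(F̄) = ∂B₁ ∩ {x : sign(D*x) = s̄}. -/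

import Mathlib

open Matrix Set

noncomputable section

/-- `Vec n` is `ℝ^n`. -/
abbrev Vec (n : ℕ) := Fin n → ℝ

/-- The ℓ¹-norm on `ℝ^p`. -/
def l1 {p : ℕ} (θ : Vec p) : ℝ := ∑ i, |θ i|

/-- The componentwise sign vector. -/
def sgn {p : ℕ} (θ : Vec p) : Vec p := fun i => Real.sign (θ i)

/-- `s` is a sign vector, i.e. `s ∈ {-1,0,1}^p`. -/
def IsSignVec {p : ℕ} (s : Vec p) : Prop := ∀ i, s i = -1 ∨ s i = 0 ∨ s i = 1

/-- The order `s ≼ s'` on sign vectors: `sᵢ ≠ 0 → s'ᵢ = sᵢ`. -/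
def sleq {p : ℕ} (s s' : Vec p) : Prop := ∀ i, s i ≠ 0 → s' i = s i

/-- The cosupport `{i : uᵢ = 0}`. -/
def cosupp {p : ℕ} (u : Vec p) : Set (Fin p) := {i | u i = 0}

/-- The analysis operator `D* x = Dᵀ x`. -/
def Dstar {n p : ℕ} (D : Matrix (Fin n) (Fin p) ℝ) (x : Vec n) : Vec p := Dᵀ *ᵥ x

/-- The ball `B_r = {x : ‖D*x‖₁ ≤ r}`. -/
def Ball {n p : ℕ} (D : Matrix (Fin n) (Fin p) ℝ) (r : ℝ) : Set (Vec n) :=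
  {x | l1 (Dstar D x) ≤ r}

/-- The sphere `∂B_r = {x : ‖D*x‖₁ = r}`. -/
def Sph {n p : ℕ} (D : Matrix (Fin n) (Fin p) ℝ) (r : ℝ) : Set (Vec n) :=
  {x | l1 (Dstar D x) = r}

/-- `Ker D*_J = {x : (D*x)ᵢ = 0 for all i ∈ J}`. -/
def kerDJ {n p : ℕ} (D : Matrix (Fin n) (Fin p) ℝ) (J : Set (Fin p)) : Set (Vec n) :=
  {x | ∀ i ∈ J, Dstar D x i = 0}

/-- The relative interior of a set. -/
def ri {n : ℕ} (C : Set (Vec n)) : Set (Vec n) := intrinsicInterior ℝ C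

/-- The direction of (the affine hull of) a set, as a set of vectors. -/
def dir {n : ℕ} (C : Set (Vec n)) : Set (Vec n) := ((affineSpan ℝ C).direction : Set (Vec n))

/-- `F` is an exposed face of `X`: the intersection of `X` with a supporting hyperplane. -/
def IsExposedFace {n : ℕ} (X F : Set (Vec n)) : Prop :=
  ∃ (α : Vec n) (β : ℝ), α ≠ 0 ∧ (∀ x ∈ X, α ⬝ᵥ x ≤ β) ∧ F = X ∩ {x | α ⬝ᵥ x = β}

/-- `G` is a face of `X`: a convex extreme subset of `X`. -/
def IsFace {n : ℕ} (X G : Set (Vec n)) : Prop := Convex ℝ G ∧ IsExtreme ℝ X G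

/-- `x` is an extreme point of `C`: it is not the midpoint of two distinct points of `C`. -/
def IsExtremePt {n : ℕ} (C : Set (Vec n)) (x : Vec n) : Prop :=
  x ∈ C ∧ ∀ x₁ ∈ C, ∀ x₂ ∈ C, x = midpoint ℝ x₁ x₂ → x₁ = x₂

/-- The objective `L(x) = (1/2)‖y − Φx‖₂² + λ‖D*x‖₁`. -/
def Lfun {n p q : ℕ} (D : Matrix (Fin n) (Fin p) ℝ) (Phi : Matrix (Fin q) (Fin n) ℝ)
    (y : Vec q) (lam : ℝ) (x : Vec n) : ℝ :=
  (1/2 : ℝ) * ((y - Phi *ᵥ x) ⬝ᵥ (y - Phi *ᵥ x)) + lam * l1 (Dstar D x)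

theorem aux_phi {n p : ℕ} (D : Matrix (Fin n) (Fin p) ℝ) (s : Vec p) (x : Vec n) :
    (D *ᵥ s) ⬝ᵥ x = ∑ i, s i * Dstar D x i := by
  have h : (D *ᵥ s) ⬝ᵥ x = s ⬝ᵥ (Dᵀ *ᵥ x) := by
    rw [Matrix.dotProduct_mulVec, Matrix.vecMul_transpose]
  rw [h]; rfl

theorem aux_lin {n p : ℕ} (D : Matrix (Fin n) (Fin p) ℝ) (x y : Vec n) (t : ℝ) :
    Dstar D (x + t • y) = Dstar D x + t • Dstar D y := by
  simp [Dstar, Matrix.mulVec_add, Matrix.mulVec_smul]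

theorem aux_sub {n p : ℕ} (D : Matrix (Fin n) (Fin p) ℝ) (x y : Vec n) :
    Dstar D (x - y) = Dstar D x - Dstar D y := by
  simp [Dstar, Matrix.mulVec_sub]

theorem aux_cont {n p : ℕ} (D : Matrix (Fin n) (Fin p) ℝ) : Continuous (Dstar D) := by
  unfold Dstar; fun_prop

theorem aux_ext {n : ℕ} (C : Set (Vec n)) (x y : Vec n) (hx : x ∈ ri C) (hy : y ∈ C) :
    ∃ ε : ℝ, 0 < ε ∧ x + ε • (x - y) ∈ C := by
  obtain ⟨z, hz, rfl⟩ := mem_intrinsicInterior.1 hx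
  let ys : affineSpan ℝ C := ⟨y, subset_affineSpan ℝ C hy⟩
  have hmem : ∀ t : ℝ, (z : Vec n) + t • ((z : Vec n) - y) ∈ affineSpan ℝ C := by
    intro t
    have := AffineMap.lineMap_mem (Q := affineSpan ℝ C) (-t) z.2 ys.2
    convert this using 1
    ext i
    simp [AffineMap.lineMap_apply, ys]; ring
  let f : ℝ → affineSpan ℝ C := fun t => ⟨(z : Vec n) + t • ((z : Vec n) - y), hmem t⟩
  have hf : Continuous f := by
    apply Continuous.subtype_mk; fun_prop
  have hf0 : f 0 = z := by ext; simp [f]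
  have h1 : f ⁻¹' (interior ((↑) ⁻¹' C)) ∈ nhds (0 : ℝ) := by
    apply (isOpen_interior.preimage hf).mem_nhds
    simpa [hf0] using hz
  obtain ⟨ε, hε, hb⟩ := Metric.mem_nhds_iff.1 h1
  refine ⟨ε / 2, by positivity, ?_⟩
  have h2 : (ε / 2) ∈ Metric.ball (0 : ℝ) ε := by
    rw [Metric.mem_ball, dist_zero_right, Real.norm_eq_abs, abs_of_pos (by positivity)]; linarith
  have h3 : f (ε / 2) ∈ ((↑) ⁻¹' C : Set (affineSpan ℝ C)) := interior_subset (hb h2)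
  exact h3

theorem aux_sign_mul (a b : ℝ) : Real.sign a * b ≤ |b| := by
  rcases Real.sign_apply_eq a with h | h | h <;> rw [h]
  · linarith [neg_abs_le b]
  · simp
  · linarith [le_abs_self b]

theorem aux_sign_eq (a b : ℝ) :
    Real.sign a * b = |b| ↔ (Real.sign b ≠ 0 → Real.sign a = Real.sign b) := by
  rcases lt_trichotomy b 0 with hb | hb | hb
  · rw [abs_of_neg hb, Real.sign_of_neg hb]
    rcases Real.sign_apply_eq a with h | h | h <;> rw [h] <;> norm_num <;> grind
  · subst hb; simp
  · rw [abs_of_pos hb, Real.sign_of_pos hb]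
    rcases Real.sign_apply_eq a with h | h | h <;> rw [h] <;> norm_num <;> grind

theorem aux_sign_pos (a b : ℝ) (h : 0 < Real.sign a * b) : Real.sign b = Real.sign a := by
  rcases Real.sign_apply_eq a with h' | h' | h' <;> rw [h'] at h ⊢
  · exact Real.sign_of_neg (by linarith)
  · simp at h
  · exact Real.sign_of_pos (by linarith)

theorem aux_sign_self (a : ℝ) : Real.sign a * a = |a| := (aux_sign_eq a a).2 (fun _ => rfl)

/-- properties of the exposed face `F̄ = B₁ ∩ {x : ⟨Ds̄, x⟩ = 1}` attached to a point
`x̄ ∈ ∂B₁`, with `s̄ = sign(D*x̄)` and `J̄ = cosupp(D*x̄)`. -/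
theorem stmt_4 {n p : ℕ} (hn : 0 < n) (hp : 0 < p) (D : Matrix (Fin n) (Fin p) ℝ)
    (xb : Vec n) (hxb : xb ∈ Sph D 1)
    (sb : Vec p) (hsb : sb = sgn (Dstar D xb))
    (Jb : Set (Fin p)) (hJb : Jb = cosupp (Dstar D xb))
    (Fb : Set (Vec n)) (hFb : Fb = Ball D 1 ∩ {x | (D *ᵥ sb) ⬝ᵥ x = 1}) :
    -- (i)
    (Fb = Sph D 1 ∩ {x | sleq (sgn (Dstar D x)) sb} ∧ xb ∈ Fb ∧ IsExposedFace (Ball D 1) Fb) ∧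
    -- (ii)
    (∀ C : Set (Vec n), C.Nonempty → Convex ℝ C → C ⊆ Ball D 1 → xb ∈ ri C → C ⊆ Fb) ∧
    -- (iii)
    dir Fb = {d : Vec n | (D *ᵥ sb) ⬝ᵥ d = 0} ∩ kerDJ D Jb ∧
    -- (iv)
    (∀ C : Set (Vec n), C.Nonempty → Convex ℝ C → C ⊆ Ball D 1 → xb ∈ ri C → ri C ⊆ ri Fb) ∧
    -- (v)
    ri Fb = Sph D 1 ∩ {x | sgn (Dstar D x) = sb} := by
  have hle : ∀ x, (D *ᵥ sb) ⬝ᵥ x ≤ l1 (Dstar D x) := by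
    intro x
    rw [aux_phi, hsb]
    exact Finset.sum_le_sum fun i _ => aux_sign_mul _ _
  have hphi : ∀ x, (D *ᵥ sb) ⬝ᵥ x = l1 (Dstar D x) ↔ sleq (sgn (Dstar D x)) sb := by
    intro x
    rw [aux_phi, hsb]
    unfold l1
    simp only [sgn]
    rw [Finset.sum_eq_sum_iff_of_le fun i _ => aux_sign_mul _ _]
    constructor
    · intro h i; exact (aux_sign_eq _ _).1 (h i (Finset.mem_univ i))
    · intro h i _; exact (aux_sign_eq _ _).2 (h i)
  have hF : Fb = Sph D 1 ∩ {x | sleq (sgn (Dstar D x)) sb} := by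
    rw [hFb]
    ext x
    simp only [Ball, Sph, mem_inter_iff, mem_ofPred_eq]
    have h1 := hle x
    rw [← hphi]
    constructor
    · rintro ⟨h2, h3⟩; constructor <;> linarith
    · rintro ⟨h2, h3⟩; constructor <;> linarith
  have hF' : ∀ x ∈ Fb, (D *ᵥ sb) ⬝ᵥ x = 1 := by
    intro x hx; rw [hFb] at hx; exact hx.2
  have hxF : xb ∈ Fb := by
    rw [hF]; refine ⟨hxb, ?_⟩
    intro i _; rw [hsb]
  have hJs : ∀ i, i ∈ Jb ↔ sb i = 0 := by
    intro i
    rw [hJb, hsb]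
    exact Real.sign_eq_zero_iff.symm
  have hFker : ∀ x ∈ Fb, ∀ i ∈ Jb, Dstar D x i = 0 := by
    intro x hx i hi
    rw [hF] at hx
    have h1 := hx.2 i
    rw [(hJs i).1 hi] at h1
    by_contra h
    have h2 : sgn (Dstar D x) i ≠ 0 := fun h3 => h (Real.sign_eq_zero_iff.1 h3)
    exact h2 (h1 h2).symm
  have hii : ∀ C : Set (Vec n), C ⊆ Ball D 1 → xb ∈ ri C → C ⊆ Fb := by
    intro C hC hx y hy
    obtain ⟨ε, hε, h⟩ := aux_ext C xb y hx hy
    have h1 := (hle _).trans (hC h)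
    rw [dotProduct_add, dotProduct_smul, dotProduct_sub, hF' xb hxF, smul_eq_mul] at h1
    have h2 := (hle y).trans (hC hy)
    rw [hFb]
    refine ⟨hC hy, ?_⟩
    show (D *ᵥ sb) ⬝ᵥ y = 1
    nlinarith
  have hsgn : ∀ C : Set (Vec n), C ⊆ Fb → xb ∈ C → ∀ z ∈ ri C, z ∈ Sph D 1 ∩ {x | sgn (Dstar D x) = sb} := by
    intro C hC hx z hz
    have hzF : z ∈ Fb := hC (intrinsicInterior_subset hz)
    obtain ⟨ε, hε, h⟩ := aux_ext C z xb hz hx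
    have h1 := hC h
    rw [hF] at hzF h1
    refine ⟨hzF.1, ?_⟩
    funext i
    by_contra hne
    have h2 : sgn (Dstar D z) i = 0 := by
      by_contra h3; exact hne (hzF.2 i h3).symm
    have h4 : Dstar D z i = 0 := Real.sign_eq_zero_iff.1 h2
    have h5 : sb i ≠ 0 := fun h6 => hne (h2.trans h6.symm)
    have h7 := h1.2 i
    simp only [sgn, aux_lin, aux_sub, Pi.add_apply, Pi.smul_apply, Pi.sub_apply, h4, smul_eq_mul] at h7
    rw [hsb] at h5 h7
    simp only [sgn] at h5 h7
    have := aux_sign_eq (Dstar D xb i) (0 + ε * (0 - Dstar D xb i))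
    rw [← this] at h7
    have h8 := aux_sign_self (Dstar D xb i)
    have h9 : 0 < |Dstar D xb i| := abs_pos.2 fun h => h5 (by rw [h, Real.sign_zero])
    have h10 := abs_nonneg (0 + ε * (0 - Dstar D xb i))
    nlinarith
  have hopen : ∀ x, sgn (Dstar D x) = sb → ∃ U : Set (Vec n), IsOpen U ∧ x ∈ U ∧
      ∀ z ∈ U, (D *ᵥ sb) ⬝ᵥ z = 1 → z ∈ kerDJ D Jb → z ∈ Fb := by
    intro x hx
    refine ⟨⋂ i : Fin p, {z | sb i ≠ 0 → 0 < sb i * Dstar D z i}, ?_, ?_, ?_⟩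
    · apply isOpen_iInter_of_finite
      intro i
      by_cases hi : sb i = 0
      · simp [hi]
      · simp only [ne_eq, hi, not_false_eq_true, forall_const]
        have := aux_cont D
        exact isOpen_lt continuous_const (by fun_prop)
    · refine mem_iInter.2 fun i hi => ?_
      rw [← hx] at hi ⊢
      simp only [sgn] at hi ⊢
      rw [aux_sign_self]
      exact abs_pos.2 fun h => hi (by rw [h, Real.sign_zero])
    · intro z hz h1 hk
      have hs : sleq (sgn (Dstar D z)) sb := by
        intro i hi
        have hi0 : sb i ≠ 0 := by
          intro h0
          exact hi (Real.sign_eq_zero_iff.2 (hk i ((hJs i).2 h0)))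
        have h2 := mem_iInter.1 hz i hi0
        rw [hsb] at h2 ⊢
        exact (aux_sign_pos _ _ h2).symm
      rw [hF]
      refine ⟨?_, hs⟩
      show l1 (Dstar D z) = 1
      rw [← (hphi z).2 hs, h1]
  let V : Submodule ℝ (Vec n) :=
    { carrier := {d : Vec n | (D *ᵥ sb) ⬝ᵥ d = 0} ∩ kerDJ D Jb
      zero_mem' := by
        refine ⟨dotProduct_zero _, ?_⟩
        intro i _; simp [Dstar]
      add_mem' := by
        rintro a b ⟨ha, ha'⟩ ⟨hb, hb'⟩
        refine ⟨?_, ?_⟩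
        · simp only [mem_ofPred_eq] at ha hb ⊢
          rw [dotProduct_add, ha, hb, add_zero]
        · intro i hi
          have := ha' i hi
          have := hb' i hi
          simp_all [Dstar, Matrix.mulVec_add]
      smul_mem' := by
        rintro c a ⟨ha, ha'⟩
        refine ⟨?_, ?_⟩
        · simp only [mem_ofPred_eq] at ha ⊢
          rw [dotProduct_smul, ha, smul_zero]
        · intro i hi
          have := ha' i hi
          simp_all [Dstar, Matrix.mulVec_smul] }
  have hdirle : (affineSpan ℝ Fb).direction ≤ V := by
    rw [direction_affineSpan, vectorSpan_def, Submodule.span_le]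
    rintro _ ⟨a, ha, b, hb, rfl⟩
    refine ⟨?_, ?_⟩
    · show (D *ᵥ sb) ⬝ᵥ (a - b) = 0
      rw [dotProduct_sub, hF' a ha, hF' b hb, sub_self]
    · intro i hi
      show Dstar D (a - b) i = 0
      rw [aux_sub, Pi.sub_apply, hFker a ha i hi, hFker b hb i hi, sub_self]
  have hspan : ∀ z ∈ affineSpan ℝ Fb, (D *ᵥ sb) ⬝ᵥ z = 1 ∧ z ∈ kerDJ D Jb := by
    intro z hz
    have h1 : z - xb ∈ V := hdirle
      (AffineSubspace.vsub_mem_direction hz (subset_affineSpan ℝ Fb hxF))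
    obtain ⟨h2, h3⟩ : z - xb ∈ {d : Vec n | (D *ᵥ sb) ⬝ᵥ d = 0} ∩ kerDJ D Jb := h1
    constructor
    · rw [mem_ofPred_eq, dotProduct_sub, hF' xb hxF] at h2; linarith
    · intro i hi
      have := h3 i hi
      rw [aux_sub, Pi.sub_apply, hFker xb hxF i hi] at this
      linarith
  have hv : ri Fb = Sph D 1 ∩ {x | sgn (Dstar D x) = sb} := by
    apply Subset.antisymm
    · exact hsgn Fb Subset.rfl hxF
    · rintro x ⟨hx1, hx2⟩
      have hxF' : x ∈ Fb := by
        rw [hF]; refine ⟨hx1, ?_⟩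
        intro i _; rw [← show sgn (Dstar D x) = sb from hx2]
      obtain ⟨U, hU, hxU, h⟩ := hopen x hx2
      refine mem_intrinsicInterior.2 ⟨⟨x, subset_affineSpan ℝ Fb hxF'⟩, ?_, rfl⟩
      refine mem_interior.2 ⟨(Subtype.val ⁻¹' U : Set (affineSpan ℝ Fb)), ?_, hU.preimage continuous_subtype_val, hxU⟩
      intro z hz
      exact h z hz (hspan z z.2).1 (hspan z z.2).2
  refine ⟨⟨hF, hxF, D *ᵥ sb, 1, ?_, fun x hx => (hle x).trans hx, hFb⟩,
    fun C _ _ hC hx => hii C hC hx, ?_, ?_, hv⟩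
  · intro h0
    have := hF' xb hxF
    rw [h0, zero_dotProduct] at this
    norm_num at this
  · apply Subset.antisymm
    · exact hdirle
    · rintro d ⟨hd1, hd2⟩
      obtain ⟨U, hU, hxU, h⟩ := hopen xb hsb.symm
      have hc : Continuous fun t : ℝ => xb + t • d := by fun_prop
      have hn' : (fun t : ℝ => xb + t • d) ⁻¹' U ∈ nhds (0 : ℝ) :=
        (hU.preimage hc).mem_nhds (by simpa using hxU)
      obtain ⟨ε, hε, hb⟩ := Metric.mem_nhds_iff.1 hn'
      have h2 : (ε / 2) ∈ Metric.ball (0 : ℝ) ε := by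
        rw [Metric.mem_ball, dist_zero_right, Real.norm_eq_abs, abs_of_pos (by positivity)]
        linarith
      have h3 : xb + (ε / 2) • d ∈ Fb := by
        refine h _ (hb h2) ?_ ?_
        · rw [dotProduct_add, dotProduct_smul, hF' xb hxF, show (D *ᵥ sb) ⬝ᵥ d = 0 from hd1]; simp
        · intro i hi
          rw [aux_lin, Pi.add_apply, Pi.smul_apply, hFker xb hxF i hi, hd2 i hi]; simp
      have h4 : (ε / 2) • d ∈ (affineSpan ℝ Fb).direction := by
        have := AffineSubspace.vsub_mem_direction (subset_affineSpan ℝ Fb h3)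
          (subset_affineSpan ℝ Fb hxF)
        simpa using this
      exact (Submodule.smul_mem_iff _ (by positivity : ε / 2 ≠ 0)).1 h4
  · intro C _ _ hC hx z hz
    rw [hv]
    exact hsgn C (hii C hC hx) (intrinsicInterior_subset hx) z hz
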